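/- Let ℰ : ℂ → SL(2,ℂ) be a holomorphic Legendrian curve whose canonical form coefficients ω̂, θ̂ have no common zeros and satisfy |θ̂(z)| ≠ |ω̂(z)| for every z ∈ ℂ, and suppose the metric ds²₁,₁ = (|ω̂(z)|² + |θ̂(z)|²)|dz|² is complete on ℂ. Then ω̂ and θ̂ are both constant; consequently the corresponding flat surface f = ℰℰ* in hyperbolic three-space is a horosphere or a hyperbolic cylinder. -/

import Mathlib

open MeasureTheory Set
open scoped ENNReal Classical Matrix

noncomputable section

/-- A path `γ : [0,1) → ℂ` is divergent if it eventually leaves every compact set. -/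
def DivergentPath (γ : ℝ → ℂ) : Prop :=
  ∀ K : Set ℂ, IsCompact K → ∃ t₀ ∈ Ico (0:ℝ) 1, ∀ t ∈ Ico t₀ 1, γ t ∉ K

/-- Length of `γ : [0,1) → ℂ` for the conformal metric `lam(z)²|dz|²`. -/
def PathLength (lam : ℂ → ℝ) (γ : ℝ → ℂ) : ℝ≥0∞ :=
  ∫⁻ t in Ico (0:ℝ) 1, ENNReal.ofReal (lam (γ t) * ‖derivWithin γ (Ico (0:ℝ) 1) t‖)

/-- The conformal metric `lam(z)²|dz|²` on `Ω` is complete: every (C¹) divergent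
path in `Ω` has infinite length. -/
def ConformalComplete (Ω : Set ℂ) (lam : ℂ → ℝ) : Prop :=
  ∀ γ : ℝ → ℂ, ContDiffOn ℝ 1 γ (Ico (0:ℝ) 1) → MapsTo γ (Ico (0:ℝ) 1) Ω →
    DivergentPath γ → PathLength lam γ = ⊤

/-- The ratio `ρ = θ̂/ω̂ : Ω → ℂ ∪ {∞}` of the canonical forms of a holomorphic
Legendrian curve. -/
def canonicalRatio (om th : ℂ → ℂ) (z : ℂ) : OnePoint ℂ :=
  if om z = 0 then OnePoint.infty else ((th z / om z : ℂ) : OnePoint ℂ)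

/-- `E : Ω → SL(2,ℂ)` is a holomorphic Legendrian curve with canonical form
coefficients `ω̂ = om` and `θ̂ = th`: `E` is holomorphic with `det E = 1` and
`E⁻¹E′ = [[0, θ̂],[ω̂, 0]]`, with `ω̂`, `θ̂` holomorphic on `Ω`. -/
structure IsLegendrian (Ω : Set ℂ) (E : ℂ → Matrix (Fin 2) (Fin 2) ℂ)
    (om th : ℂ → ℂ) : Prop where
  holo : ∀ i j, DifferentiableOn ℂ (fun z => E z i j) Ω
  det_one : ∀ z ∈ Ω, (E z).det = 1
  om_holo : DifferentiableOn ℂ om Ω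
  th_holo : DifferentiableOn ℂ th Ω
  legendrian : ∀ z ∈ Ω, ∀ i j,
    deriv (fun w => E w i j) z = (E z * Matrix.of ![![0, th z], ![om z, 0]]) i j
open Filter Topology Metric

/-- An entire function of at most linear growth is affine. -/
theorem eq_affine_of_norm_le {h : ℂ → ℂ} (hh : Differentiable ℂ h) {C : ℝ}
    (hC : ∀ z, ‖h z‖ ≤ C + ‖z‖) : ∃ a b : ℂ, ∀ z, h z = a + z * b := by
  have hd : Differentiable ℂ (dslope h 0) := by
    rw [← differentiableOn_univ, Complex.differentiableOn_dslope univ_mem]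
    exact hh.differentiableOn
  have hbdd : Bornology.IsBounded (range (dslope h 0)) := by
    obtain ⟨M, hM⟩ := (isCompact_closedBall (0 : ℂ) 1).exists_bound_of_continuousOn
      hd.continuous.continuousOn
    refine isBounded_iff_forall_norm_le.2 ⟨max M (|C| + 1 + ‖h 0‖), ?_⟩
    rintro _ ⟨z, rfl⟩
    by_cases hz : ‖z‖ ≤ 1
    · exact (hM z (by simpa using hz)).trans (le_max_left _ _)
    · push Not at hz
      refine le_trans ?_ (le_max_right _ _)
      have hz0 : z ≠ 0 := by rintro rfl; simp at hz; linarith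
      rw [dslope_of_ne _ hz0, slope_def_field, norm_div, sub_zero,
        div_le_iff₀ (by linarith)]
      have h1 := norm_sub_le (h z) (h 0)
      have h2 := hC z
      nlinarith [le_abs_self C, abs_nonneg C, norm_nonneg (h 0)]
  obtain ⟨b, hb⟩ := hd.exists_const_forall_eq_of_bounded hbdd
  refine ⟨h 0, b, fun z => ?_⟩
  have := sub_smul_dslope h 0 z
  rw [hb, smul_eq_mul] at this
  linear_combination -this

/-- An entire function whose only zero is a simple zero at the origin, and which is bounded away
from `0` outside a bounded set, is linear. -/
theorem eq_mul_of_bounded_preimage {F : ℂ → ℂ} (hF : Differentiable ℂ F) (h0 : F 0 = 0)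
    (hd0 : deriv F 0 ≠ 0) (hz : ∀ z, F z = 0 → z = 0)
    (hb : Bornology.IsBounded (F ⁻¹' closedBall 0 1)) : ∃ c : ℂ, ∀ z, F z = z * c := by
  have hd : Differentiable ℂ (dslope F 0) := by
    rw [← differentiableOn_univ, Complex.differentiableOn_dslope univ_mem]
    exact hF.differentiableOn
  have hmul : ∀ z, z * dslope F 0 z = F z := fun z => by
    simpa [h0] using sub_smul_dslope F 0 z
  have hne : ∀ z, dslope F 0 z ≠ 0 := fun z hzero => by
    by_cases hz0 : z = 0
    · subst hz0; rw [dslope_same] at hzero; exact hd0 hzero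
    · exact hz0 (hz z (by rw [← hmul, hzero, mul_zero]))
  have hi : Differentiable ℂ (fun z => (dslope F 0 z)⁻¹) := hd.inv hne
  obtain ⟨R, hR⟩ := hb.subset_closedBall 0
  obtain ⟨M, hM⟩ := (isCompact_closedBall (0 : ℂ) R).exists_bound_of_continuousOn
    hi.continuous.continuousOn
  obtain ⟨a, b, hab⟩ := eq_affine_of_norm_le (C := |M|) hi fun z => by
    by_cases hzR : z ∈ closedBall (0 : ℂ) R
    · linarith [hM z hzR, le_abs_self M, norm_nonneg z]
    · have h1 : 1 < ‖F z‖ := by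
        by_contra! hle
        exact hzR (hR (by simpa using hle))
      have h2 : ‖(dslope F 0 z)⁻¹‖ * ‖F z‖ = ‖z‖ := by
        rw [← norm_mul, ← hmul z]
        congr 1
        field_simp [hne z]
      nlinarith [norm_nonneg (dslope F 0 z)⁻¹, abs_nonneg M]
  have hb0 : b = 0 := by
    by_contra hb0
    have h1 := hab (-a / b)
    rw [div_mul_cancel₀ _ hb0, add_neg_cancel] at h1
    exact inv_ne_zero (hne _) h1
  refine ⟨a⁻¹, fun z => ?_⟩
  rw [← hmul z, ← inv_inv (dslope F 0 z), hab z, hb0, mul_zero, add_zero]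

theorem isLocalHomeomorph_of_hasDerivAt {F om : ℂ → ℂ} (hF : ∀ z, HasDerivAt F (om z) z)
    (hne : ∀ z, om z ≠ 0) : IsLocalHomeomorph F := by
  have hd : Differentiable ℂ F := fun z => (hF z).differentiableAt
  refine IsLocalHomeomorph.mk F fun z => ?_
  have hs : HasStrictDerivAt F (om z) z := by
    have := (hd.analyticAt z).hasStrictDerivAt
    rwa [(hF z).deriv] at this
  have he := hs.hasStrictFDerivAt_equiv (hne z)
  exact ⟨he.toOpenPartialHomeomorph F, he.mem_toOpenPartialHomeomorph_source, fun _ _ => rfl⟩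

/-- A continuous lift `γ` of a segment through a map `F` with nonvanishing derivative `om` is
differentiable, and its velocity is obtained by dividing by `om`. -/
theorem hasDerivWithinAt_lift {F om : ℂ → ℂ} (hF : ∀ z, HasDerivAt F (om z) z)
    (hne : ∀ z, om z ≠ 0) {γ : ℝ → ℂ} {s : Set ℝ} {w : ℂ} (hγ : ContinuousOn γ s)
    (hlift : ∀ t ∈ s, F (γ t) = t * w) {t : ℝ} (ht : t ∈ s) :
    HasDerivWithinAt γ ((om (γ t))⁻¹ * w) s t := by
  obtain ⟨e, hmem, rfl⟩ := isLocalHomeomorph_of_hasDerivAt hF hne (γ t)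
  have hsymm : HasDerivAt e.symm (om (γ t))⁻¹ ((t : ℂ) * w) := by
    refine e.hasDerivAt_symm ?_ (hne _) ?_
    · rw [← hlift t ht]; exact e.map_source hmem
    · rw [← hlift t ht, e.left_inv hmem]; exact hF _
  have hlin : HasDerivAt (fun t : ℝ => (t : ℂ) * w) w t := by
    simpa using (Complex.ofRealCLM.hasDerivAt (x := t)).mul_const w
  have hcomp := (hsymm.comp_of_eq t hlin rfl).hasDerivWithinAt (s := s)
  refine hcomp.congr_of_eventuallyEq ?_ ?_
  · filter_upwards [hγ t ht (e.open_source.mem_nhds hmem), self_mem_nhdsWithin] with u hu hus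
    rw [Function.comp_apply, ← hlift u hus, e.left_inv hu]
  · rw [Function.comp_apply, ← hlift t ht, e.left_inv hmem]

/-- A lift of a half-open segment has finite length, hence does not diverge. -/
theorem not_divergentPath_of_lift {F om : ℂ → ℂ} (hF : ∀ z, HasDerivAt F (om z) z)
    (hom : Continuous om) (hne : ∀ z, om z ≠ 0) {C : ℝ}
    (hcomp : ConformalComplete univ (fun z => C * ‖om z‖))
    {γ : ℝ → ℂ} {w : ℂ} (hγ : ContinuousOn γ (Ico 0 1))
    (hlift : ∀ t ∈ Ico (0 : ℝ) 1, F (γ t) = t * w) : ¬ DivergentPath γ := by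
  intro hdiv
  have hu : UniqueDiffOn ℝ (Ico (0 : ℝ) 1) := uniqueDiffOn_Ico 0 1
  have hd : ∀ t ∈ Ico (0 : ℝ) 1,
      HasDerivWithinAt γ ((om (γ t))⁻¹ * w) (Ico 0 1) t :=
    fun t ht => hasDerivWithinAt_lift hF hne hγ hlift ht
  have hdw : ∀ t ∈ Ico (0 : ℝ) 1, derivWithin γ (Ico 0 1) t = (om (γ t))⁻¹ * w :=
    fun t ht => (hd t ht).derivWithin (hu t ht)
  have hsmooth : ContDiffOn ℝ 1 γ (Ico 0 1) := by
    rw [contDiffOn_one_iff_derivWithin hu]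
    refine ⟨fun t ht => (hd t ht).differentiableWithinAt, ContinuousOn.congr ?_ hdw⟩
    exact ((hom.comp_continuousOn hγ).inv₀ fun t _ => hne _).mul continuousOn_const
  have htop := hcomp γ hsmooth (mapsTo_univ _ _) hdiv
  have hlen : PathLength (fun z => C * ‖om z‖) γ =
      ∫⁻ _ in Ico (0 : ℝ) 1, ENNReal.ofReal (C * ‖w‖) := by
    refine setLIntegral_congr_fun measurableSet_Ico fun t ht => ?_
    have : ‖om (γ t)‖ ≠ 0 := norm_ne_zero_iff.2 (hne _)
    simp only [hdw t ht, norm_mul, norm_inv]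
    congr 1
    field_simp
  rw [hlen] at htop
  simp at htop

/-- A continuous lift of `[0, T) ∋ t ↦ t * w` can be continued past `T`. -/
theorem exists_lift_extension {F om : ℂ → ℂ} (hF : ∀ z, HasDerivAt F (om z) z)
    (hom : Continuous om) (hne : ∀ z, om z ≠ 0) {C : ℝ}
    (hcomp : ConformalComplete univ (fun z => C * ‖om z‖))
    {γ : ℝ → ℂ} {w : ℂ} {T : ℝ} (hT : 0 < T) (hγ : ContinuousOn γ (Ico 0 T))
    (hlift : ∀ t ∈ Ico (0 : ℝ) T, F (γ t) = t * w) :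
    ∃ T' > T, ∃ δ : ℝ → ℂ, ContinuousOn δ (Icc 0 T') ∧ δ 0 = γ 0 ∧
      ∀ t ∈ Icc (0 : ℝ) T', F (δ t) = t * w := by
  have hmaps : MapsTo (fun s : ℝ => s * T) (Ico 0 1) (Ico 0 T) := fun s hs =>
    ⟨mul_nonneg hs.1 hT.le, by nlinarith [hs.2]⟩
  have hnd := not_divergentPath_of_lift (γ := fun s => γ (s * T)) (w := T * w) hF hom hne hcomp
    (hγ.comp (by fun_prop) hmaps) fun s hs => by
      rw [hlift _ (hmaps hs)]; push_cast; ring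
  simp only [DivergentPath] at hnd
  push Not at hnd
  obtain ⟨K, hK, hret⟩ := hnd
  have hseq : ∀ n : ℕ, ∃ t ∈ Ico (1 - 1 / ((n : ℝ) + 1)) 1, 0 ≤ t ∧ γ (t * T) ∈ K := fun n => by
    have h1 : 1 / ((n : ℝ) + 1) ≤ 1 := by
      rw [div_le_one (by positivity)]; linarith [n.cast_nonneg (α := ℝ)]
    have h2 : (0 : ℝ) < 1 / ((n : ℝ) + 1) := by positivity
    obtain ⟨t, ht, htK⟩ := hret (1 - 1 / ((n : ℝ) + 1)) ⟨by linarith, by linarith⟩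
    exact ⟨t, ht, by linarith [ht.1], htK⟩
  choose u hu hu0 huK using hseq
  have hu1 : Tendsto u atTop (𝓝 1) := by
    refine tendsto_of_tendsto_of_tendsto_of_le_of_le (g := fun n : ℕ => 1 - 1 / ((n : ℝ) + 1))
      ?_ tendsto_const_nhds (fun n => (hu n).1) (fun n => (hu n).2.le)
    simpa using (tendsto_one_div_add_atTop_nhds_zero_nat (𝕜 := ℝ)).const_sub 1
  obtain ⟨p, -, φ, hφ, hp⟩ := hK.tendsto_subseq huK
  have hv : Tendsto (fun n => u (φ n) * T) atTop (𝓝 T) := by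
    simpa using (hu1.comp hφ.tendsto_atTop).mul_const T
  have hvT : ∀ n, u (φ n) * T ∈ Ico 0 T := fun n => hmaps ⟨hu0 _, (hu _).2⟩
  obtain ⟨e, hmem, rfl⟩ := isLocalHomeomorph_of_hasDerivAt hF hne p
  have hlim : e p = T * w := by
    refine tendsto_nhds_unique (((hF p).continuousAt.tendsto).comp hp) ?_
    have : Tendsto (fun n => ((u (φ n) * T : ℝ) : ℂ) * w) atTop (𝓝 (T * w)) :=
      ((Complex.continuous_ofReal.tendsto T).comp hv).mul_const w
    exact this.congr fun n => (hlift _ (hvT n)).symm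
  have htarget : {t : ℝ | (t : ℂ) * w ∈ e.target} ∈ 𝓝 T := by
    have hc : Continuous fun t : ℝ => (t : ℂ) * w := by fun_prop
    exact hc.continuousAt.preimage_mem_nhds
      (e.open_target.mem_nhds (hlim ▸ e.map_source hmem))
  obtain ⟨ε, hε, hball⟩ := Metric.mem_nhds_iff.1 htarget
  obtain ⟨n, hn1, hn2⟩ :=
    ((hp.eventually_mem (e.open_source.mem_nhds hmem)).and
      (hv.eventually_mem (ball_mem_nhds T hε))).exists
  set a : ℝ := u (φ n) * T
  have haT : a ∈ Ico 0 T := hvT n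
  have haε : T - ε < a := by
    have : a ∈ ball T ε := hn2
    rw [Real.ball_eq_Ioo] at this; exact this.1
  have hgood : ∀ t ∈ Icc a (T + ε / 2), (t : ℂ) * w ∈ e.target := fun t ht => by
    refine hball ?_
    rw [Real.ball_eq_Ioo]
    exact ⟨by linarith [ht.1], by linarith [ht.2]⟩
  have hsa : e.symm ((a : ℂ) * w) = γ a := by
    rw [← hlift a haT]; exact e.left_inv hn1
  have h1 : ContinuousOn γ (Icc 0 a) := hγ.mono fun t ht => ⟨ht.1, ht.2.trans_lt haT.2⟩
  have h2 : ContinuousOn (fun t : ℝ => e.symm ((t : ℂ) * w)) (Icc a (T + ε / 2)) :=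
    e.continuousOn_symm.comp (by fun_prop) hgood
  refine ⟨T + ε / 2, by linarith, fun t => if t ≤ a then γ t else e.symm ((t : ℂ) * w),
    ?_, by simp [haT.1], fun t ht => ?_⟩
  · rw [← Icc_union_Icc_eq_Icc haT.1 (by linarith [haT.2] : a ≤ T + ε / 2)]
    refine ContinuousOn.union_of_isClosed (h1.congr fun t ht => if_pos ht.2)
      (h2.congr fun t ht => ?_) isClosed_Icc isClosed_Icc
    rcases ht.1.eq_or_lt with rfl | hlt
    · simp only [le_refl, if_true]; exact hsa.symm
    · exact if_neg hlt.not_ge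
  · by_cases hta : t ≤ a
    · simp only [hta, if_true]; exact hlift t ⟨ht.1, hta.trans_lt haT.2⟩
    · simp only [hta, if_false]; exact e.right_inv (hgood t ⟨(not_le.1 hta).le, ht.2⟩)

/-- Completeness of the metric `|dF|²` allows every segment from the origin to be lifted. -/
theorem exists_lift_segment {F om : ℂ → ℂ} (hF : ∀ z, HasDerivAt F (om z) z)
    (hom : Continuous om) (hne : ∀ z, om z ≠ 0) (h0 : F 0 = 0) {C : ℝ}
    (hcomp : ConformalComplete univ (fun z => C * ‖om z‖)) (w : ℂ) :
    ∃ γ : ℝ → ℂ, ContinuousOn γ (Icc 0 1) ∧ γ 0 = 0 ∧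
      ∀ t ∈ Icc (0 : ℝ) 1, F (γ t) = t * w := by
  set A : Set ℝ := {T | ∃ γ : ℝ → ℂ, ContinuousOn γ (Icc 0 T) ∧ γ 0 = 0 ∧
      ∀ t ∈ Icc (0 : ℝ) T, F (γ t) = t * w}
  have hmono : ∀ {S T : ℝ}, S ≤ T → T ∈ A → S ∈ A := by
    rintro S T hST ⟨γ, h1, h2, h3⟩
    exact ⟨γ, h1.mono (Icc_subset_Icc_right hST), h2,
      fun t ht => h3 t (Icc_subset_Icc_right hST ht)⟩
  have hlocal := isLocalHomeomorph_of_hasDerivAt hF hne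
  by_contra h1A
  change (1 : ℝ) ∉ A at h1A
  have hub : ∀ T ∈ A, T ≤ 1 := fun T hT => le_of_not_ge fun h => h1A (hmono h hT)
  have hbdd : BddAbove A := ⟨1, hub⟩
  have hzero : (0 : ℝ) ∈ A := by
    refine ⟨fun _ => 0, continuousOn_const, rfl, fun t ht => ?_⟩
    rw [h0, show t = 0 from le_antisymm ht.2 ht.1]; simp
  have hpos : 0 < sSup A := by
    obtain ⟨e, hmem, rfl⟩ := hlocal 0
    have hc : Continuous fun t : ℝ => (t : ℂ) * w := by fun_prop
    have htarget : {t : ℝ | (t : ℂ) * w ∈ e.target} ∈ 𝓝 0 :=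
      hc.continuousAt.preimage_mem_nhds (e.open_target.mem_nhds (by
        simpa [h0] using e.map_source hmem))
    obtain ⟨ε, hε, hball⟩ := Metric.mem_nhds_iff.1 htarget
    have hgood : ∀ t ∈ Icc 0 (ε / 2), (t : ℂ) * w ∈ e.target := fun t ht => by
      refine hball ?_
      rw [Real.ball_eq_Ioo]
      exact ⟨by linarith [ht.1], by linarith [ht.2]⟩
    have : ε / 2 ∈ A := by
      refine ⟨fun t => e.symm ((t : ℂ) * w), e.continuousOn_symm.comp (by fun_prop) hgood, ?_,
        fun t ht => e.right_inv (hgood t ht)⟩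
      have := e.left_inv hmem
      rw [h0] at this
      simpa using this
    exact (half_pos hε).trans_le (le_csSup hbdd this)
  have hlt : ∀ s : ℝ, s < sSup A → s ∈ A := fun s hs => by
    obtain ⟨T, hT, hsT⟩ := exists_lt_of_lt_csSup ⟨0, hzero⟩ hs
    exact hmono hsT.le hT
  choose! Γ hΓc hΓ0 hΓl using hlt
  have hagree : ∀ s < sSup A, EqOn (fun t => Γ t t) (Γ s) (Icc 0 s) := fun s hs t ht => by
    refine (T2Space.isSeparatedMap F).eqOn_of_comp_eqOn hlocal.isLocallyInjective
      (isPreconnected_Icc (a := (0 : ℝ)) (b := t)) (hΓc t (ht.2.trans_lt hs))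
      ((hΓc s hs).mono (Icc_subset_Icc_right ht.2)) (fun r hr => ?_)
      (left_mem_Icc.2 ht.1) ?_ (right_mem_Icc.2 ht.1)
    · simp only [Function.comp_apply]
      rw [hΓl t (ht.2.trans_lt hs) r hr, hΓl s hs r ⟨hr.1, hr.2.trans ht.2⟩]
    · rw [hΓ0 t (ht.2.trans_lt hs), hΓ0 s hs]
  obtain ⟨T', hT', δ, h1, h2, h3⟩ := exists_lift_extension (γ := fun t => Γ t t) hF hom hne
    hcomp hpos (fun t ht => by
      obtain ⟨s, hts, hs⟩ := exists_between ht.2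
      have hcont : ContinuousWithinAt (fun t => Γ t t) (Icc 0 s) t :=
        ((hΓc s hs).congr (hagree s hs)) t ⟨ht.1, hts.le⟩
      refine hcont.mono_of_mem_nhdsWithin ?_
      filter_upwards [self_mem_nhdsWithin, mem_nhdsWithin_of_mem_nhds (Iio_mem_nhds hts)]
        with r hr hrs using ⟨hr.1, le_of_lt hrs⟩)
    fun t ht => hΓl t ht.2 t ⟨ht.1, le_rfl⟩
  have : T' ∈ A := ⟨δ, h1, by rw [h2]; exact hΓ0 0 hpos, h3⟩
  exact (le_csSup hbdd this).not_gt hT'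

/-- If the flat metric `|dF|²` is complete, then `F` has a continuous inverse. -/
theorem exists_continuous_inverse {F om : ℂ → ℂ} (hF : ∀ z, HasDerivAt F (om z) z)
    (hom : Continuous om) (hne : ∀ z, om z ≠ 0) (h0 : F 0 = 0) {C : ℝ}
    (hcomp : ConformalComplete univ (fun z => C * ‖om z‖)) :
    ∃ G : ℂ → ℂ, Continuous G ∧ ∀ z, G (F z) = z := by
  have hlocal := isLocalHomeomorph_of_hasDerivAt hF hne
  have hsep := T2Space.isSeparatedMap F
  choose Γ hΓc hΓ0 hΓl using exists_lift_segment hF hom hne h0 hcomp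
  have hΓ : Continuous fun x : unitInterval × ℂ => Γ x.2 x.1 := by
    refine hlocal.continuous_lift hsep
      (f := ⟨fun x : unitInterval × ℂ => ((x.1 : ℝ) : ℂ) * x.2, by fun_prop⟩) ?_ ?_ fun w => ?_
    · ext x; exact hΓl x.2 x.1 x.1.2
    · simpa [hΓ0] using continuous_const
    · exact continuousOn_iff_continuous_domRestrict.1 (hΓc w)
  have hG : Continuous fun w => Γ w 1 := hΓ.comp (Continuous.prodMk_right (1 : unitInterval))
  have hFG : ∀ w, F (Γ w 1) = w := fun w => by
    simpa using hΓl w 1 (right_mem_Icc.2 zero_le_one)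
  refine ⟨fun w => Γ w 1, hG, fun z => ?_⟩
  have h00 : Γ 0 1 = 0 := by
    refine (hsep.eqOn_of_comp_eqOn hlocal.isLocallyInjective
      (isPreconnected_Icc (a := (0 : ℝ)) (b := 1)) (hΓc 0) continuousOn_const
      (g₂ := fun _ => 0) (fun r hr => ?_) (left_mem_Icc.2 zero_le_one) (hΓ0 0))
      (right_mem_Icc.2 zero_le_one)
    simp [hΓl 0 r hr, h0]
  refine congrFun (hsep.eq_of_comp_eq hlocal.isLocallyInjective (g₁ := fun z => Γ (F z) 1)
    (g₂ := id) (hG.comp hlocal.continuous) continuous_id ?_ 0 ?_) z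
  · ext z; exact hFG (F z)
  · simp only [h0, id, h00]

/-- A holomorphic one-form on `ℂ` without zeros inducing a complete flat metric is constant. -/
theorem eq_const_of_conformalComplete {om : ℂ → ℂ} (hom : Differentiable ℂ om)
    (hne : ∀ z, om z ≠ 0) {C : ℝ}
    (hcomp : ConformalComplete univ (fun z => C * ‖om z‖)) : ∃ a, ∀ z, om z = a := by
  obtain ⟨P, hP⟩ := hom.isExactOn_univ
  set F : ℂ → ℂ := fun z => P z - P 0
  have hF : ∀ z, HasDerivAt F (om z) z := fun z => (hP z (mem_univ z)).sub_const _
  have h0 : F 0 = 0 := sub_self _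
  obtain ⟨G, hG, hGF⟩ := exists_continuous_inverse hF hom.continuous hne h0 hcomp
  have hbdd : Bornology.IsBounded (F ⁻¹' closedBall 0 1) :=
    ((isCompact_closedBall (0 : ℂ) 1).image hG).isBounded.subset
      fun z hz => ⟨F z, hz, hGF z⟩
  obtain ⟨c, hc⟩ := eq_mul_of_bounded_preimage (fun z => (hF z).differentiableAt) h0
    ((hF 0).deriv ▸ hne 0)
    (fun z hz => (hGF z).symm.trans ((congrArg G (hz.trans h0.symm)).trans (hGF 0)))
    hbdd
  refine ⟨c, fun z => (hF z).unique ?_⟩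
  rw [show F = fun z => z * c from funext hc]
  simpa using (hasDerivAt_id z).mul_const c

/-- If `|v| < |u|` everywhere and `(|u|² + |v|²)|dz|²` is complete, then `u` and `v` are
constant. -/
theorem eq_const_of_norm_lt {u v : ℂ → ℂ} (hu : Differentiable ℂ u) (hv : Differentiable ℂ v)
    (hlt : ∀ z, ‖v z‖ < ‖u z‖)
    (hcomp : ConformalComplete univ (fun z => Real.sqrt (‖u z‖ ^ 2 + ‖v z‖ ^ 2))) :
    (∃ a, ∀ z, u z = a) ∧ ∃ b, ∀ z, v z = b := by
  have hne : ∀ z, u z ≠ 0 := fun z => norm_pos_iff.1 ((norm_nonneg _).trans_lt (hlt z))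
  obtain ⟨c, hc⟩ := (hv.div hu hne).exists_const_forall_eq_of_bounded
    (isBounded_iff_forall_norm_le.2 ⟨1, by
      rintro _ ⟨z, rfl⟩
      rw [Pi.div_apply, norm_div]
      exact div_le_one_of_le₀ (hlt z).le (norm_nonneg _)⟩)
  have hvc : ∀ z, v z = c * u z := fun z => (div_eq_iff (hne z)).1 (hc z)
  have hmetric : (fun z => Real.sqrt (‖u z‖ ^ 2 + ‖v z‖ ^ 2)) =
      fun z => Real.sqrt (1 + ‖c‖ ^ 2) * ‖u z‖ := by
    ext z
    rw [hvc, norm_mul, show ‖u z‖ ^ 2 + (‖c‖ * ‖u z‖) ^ 2 = (1 + ‖c‖ ^ 2) * ‖u z‖ ^ 2 by ring,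
      Real.sqrt_mul (by positivity), Real.sqrt_sq (norm_nonneg _)]
  rw [hmetric] at hcomp
  obtain ⟨a, ha⟩ := eq_const_of_conformalComplete hu hne hcomp
  exact ⟨⟨a, ha⟩, c * a, fun z => by rw [hvc, ha]⟩

/-- **Corollary 4.6** (on the universal cover `ℂ`): a weakly complete flat surface,
given by a holomorphic Legendrian curve `E : ℂ → SL(2,ℂ)` whose canonical form
coefficients `ω̂, θ̂` have no common zeros and satisfy `|θ̂| ≠ |ω̂|` everywhere
(no singular points), with complete metric `ds²₁,₁ = (|ω̂|²+|θ̂|²)|dz|²`, has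
constant `ω̂` and `θ̂`; consequently `f = EE*` is a horosphere or a
hyperbolic cylinder. -/
theorem weakly_complete_flat_surface_has_constant_forms
    (E : ℂ → Matrix (Fin 2) (Fin 2) ℂ) (om th : ℂ → ℂ)
    (hLeg : IsLegendrian Set.univ E om th)
    (hreg : ∀ z : ℂ, om z ≠ 0 ∨ th z ≠ 0)
    (hsing : ∀ z : ℂ, ‖th z‖ ≠ ‖om z‖)
    (hcomp : ConformalComplete Set.univ
      (fun z => Real.sqrt (‖om z‖ ^ 2 + ‖th z‖ ^ 2))) :
    (∃ a : ℂ, ∀ z : ℂ, om z = a) ∧ (∃ b : ℂ, ∀ z : ℂ, th z = b) := by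
  have hom : Differentiable ℂ om := differentiableOn_univ.1 hLeg.om_holo
  have hth : Differentiable ℂ th := differentiableOn_univ.1 hLeg.th_holo
  have hcases : (∀ z, ‖th z‖ < ‖om z‖) ∨ ∀ z, ‖om z‖ < ‖th z‖ := by
    by_contra! h
    obtain ⟨⟨z₁, h₁⟩, z₂, h₂⟩ := h
    obtain ⟨z, hz⟩ := mem_range_of_exists_le_of_exists_ge (c := (0 : ℝ))
      (f := fun z => ‖th z‖ - ‖om z‖) (hth.continuous.norm.sub hom.continuous.norm)
      ⟨z₂, sub_nonpos.2 h₂⟩ ⟨z₁, sub_nonneg.2 h₁⟩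
    exact hsing z (sub_eq_zero.1 hz)
  rcases hcases with h | h
  · exact eq_const_of_norm_lt hom hth h hcomp
  · simp_rw [add_comm (‖om _‖ ^ 2)] at hcomp
    exact (eq_const_of_norm_lt hth hom h hcomp).symm

end
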